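/- There exists a constant C independent of ε such that the energy of the vortex core satisfies ∫_{A_ε} (K_H(x)∇(u_ε − q ln(1/ε)) | ∇(u_ε − q ln(1/ε))) dx ≤ C for all sufficiently small ε > 0. -/

import Mathlib

open MeasureTheory Real Filter Topology Set

noncomputable section

/-- The bilinear form `(K_H(x) a | b)` associated with the matrix
`K_H(x) = (k²+|x|²)⁻¹ [[k²+x₂², -x₁x₂],[-x₁x₂, k²+x₁²]]`. -/
def KHform (k : ℝ) (x a b : ℝ × ℝ) : ℝ :=
  (k ^ 2 + x.1 ^ 2 + x.2 ^ 2)⁻¹ *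
    ((k ^ 2 + x.2 ^ 2) * a.1 * b.1 - x.1 * x.2 * a.1 * b.2
      - x.1 * x.2 * a.2 * b.1 + (k ^ 2 + x.1 ^ 2) * a.2 * b.2)

/-- `K_H(x)` applied to a vector `a`. -/
def KHvec (k : ℝ) (x a : ℝ × ℝ) : ℝ × ℝ :=
  ((k ^ 2 + x.1 ^ 2 + x.2 ^ 2)⁻¹ * ((k ^ 2 + x.2 ^ 2) * a.1 - x.1 * x.2 * a.2),
   (k ^ 2 + x.1 ^ 2 + x.2 ^ 2)⁻¹ * (-(x.1 * x.2) * a.1 + (k ^ 2 + x.1 ^ 2) * a.2))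

/-- `det K_H(x) = k²/(k²+|x|²)`. -/
def detKH (k : ℝ) (x : ℝ × ℝ) : ℝ := k ^ 2 / (k ^ 2 + x.1 ^ 2 + x.2 ^ 2)

/-- Gradient of a scalar function on `ℝ²`. -/
def grad (u : ℝ × ℝ → ℝ) (x : ℝ × ℝ) : ℝ × ℝ :=
  (fderiv ℝ u x (1, 0), fderiv ℝ u x (0, 1))

/-- Divergence of a vector field on `ℝ²`. -/
def div2 (F : ℝ × ℝ → ℝ × ℝ) (x : ℝ × ℝ) : ℝ :=
  fderiv ℝ (fun y => (F y).1) x (1, 0) + fderiv ℝ (fun y => (F y).2) x (0, 1)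

/-- The operator `L_H u = -div (K_H(x) ∇u)`. -/
def LH (k : ℝ) (u : ℝ × ℝ → ℝ) (x : ℝ × ℝ) : ℝ :=
  - div2 (fun y => KHvec k y (grad u y)) x

/-- Positive part `t₊ = max (t, 0)`. -/
def pPart (t : ℝ) : ℝ := max t 0

/-- Clockwise rotation through `π/2`: `a^⊥`. -/
def perp2 (a : ℝ × ℝ) : ℝ × ℝ := (a.2, -a.1)

/-- Euclidean distance in the plane. -/
def dE (a b : ℝ × ℝ) : ℝ := Real.sqrt ((a.1 - b.1) ^ 2 + (a.2 - b.2) ^ 2)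

/-- Euclidean diameter of a planar set. -/
def diamE (S : Set (ℝ × ℝ)) : ℝ := sSup {d | ∃ a ∈ S, ∃ b ∈ S, d = dE a b}

/-- Euclidean distance between two planar sets. -/
def distE (A B : Set (ℝ × ℝ)) : ℝ := sInf {d | ∃ a ∈ A, ∃ b ∈ B, d = dE a b}

/-- The function `q² √(det K_H)`. -/
def Qfun (k : ℝ) (q : ℝ × ℝ → ℝ) (x : ℝ × ℝ) : ℝ := q x ^ 2 * Real.sqrt (detKH k x)

/-- Surrogate for membership in `H(Ω) = H¹₀(Ω)` (with equivalent norm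
`‖u‖² = ∫_Ω (K_H ∇u|∇u)`). -/
def MemH (k : ℝ) (Ω : Set (ℝ × ℝ)) (u : ℝ × ℝ → ℝ) : Prop :=
  ContinuousOn u (closure Ω) ∧ ContDiffOn ℝ 1 u Ω ∧ (∀ x ∈ frontier Ω, u x = 0) ∧
    IntegrableOn (fun x => KHform k x (grad u x) (grad u x)) Ω

/-- The energy functional `I_ε`. -/
def Ieps (k p ε : ℝ) (q : ℝ × ℝ → ℝ) (Ω : Set (ℝ × ℝ)) (u : ℝ × ℝ → ℝ) : ℝ :=
  (1 / 2) * (∫ x in Ω, KHform k x (grad u x) (grad u x))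
    - (1 / ((p + 1) * ε ^ 2)) * ∫ x in Ω, pPart (u x - q x * Real.log (1 / ε)) ^ (p + 1)

/-- The mountain pass value `c_ε = inf_{γ ∈ P_ε} max_{t ∈ [0,1]} I_ε(γ(t))`, where
`P_ε` is the collection of paths in `H(Ω)` (continuous for the `H`-norm) joining `0`
to a point with negative energy. -/
def ceps (k p : ℝ) (q : ℝ × ℝ → ℝ) (Ω : Set (ℝ × ℝ)) (ε : ℝ) : ℝ :=
  sInf {c | ∃ γ : ℝ → ℝ × ℝ → ℝ,
    (∀ t ∈ Icc (0:ℝ) 1, MemH k Ω (γ t)) ∧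
    (∀ t ∈ Icc (0:ℝ) 1, ∀ δ > 0, ∃ η > 0, ∀ s ∈ Icc (0:ℝ) 1, |s - t| < η →
      (∫ x in Ω, KHform k x (grad (fun y => γ s y - γ t y) x)
        (grad (fun y => γ s y - γ t y) x)) < δ) ∧
    γ 0 = (fun _ => 0) ∧ Ieps k p ε q Ω (γ 1) < 0 ∧
    c = sSup ((fun t => Ieps k p ε q Ω (γ t)) '' Icc (0:ℝ) 1)}

/-- The Nehari manifold `N_ε`. -/
def Nehari (k p ε : ℝ) (q : ℝ × ℝ → ℝ) (Ω : Set (ℝ × ℝ)) : Set (ℝ × ℝ → ℝ) :=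
  {u | MemH k Ω u ∧ ¬ Set.EqOn u 0 Ω ∧
    (∫ x in Ω, KHform k x (grad u x) (grad u x))
      = (1 / ε ^ 2) * ∫ x in Ω, pPart (u x - q x * Real.log (1 / ε)) ^ p * u x}

/-- `u` is a (classical) solution of `L_H u = ε⁻²(u - q ln(1/ε))₊ᵖ` in `Ω`, `u = 0` on `∂Ω`. -/
def IsSolution (k p ε : ℝ) (q : ℝ × ℝ → ℝ) (Ω : Set (ℝ × ℝ)) (u : ℝ × ℝ → ℝ) : Prop :=
  ContinuousOn u (closure Ω) ∧ ContDiffOn ℝ 2 u Ω ∧ (∀ x ∈ frontier Ω, u x = 0) ∧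
    ∀ x ∈ Ω, LH k u x = (1 / ε ^ 2) * pPart (u x - q x * Real.log (1 / ε)) ^ p

/-- `u` is a mountain pass solution: a solution at the mountain pass level `c_ε`. -/
def IsMPSolution (k p ε : ℝ) (q : ℝ × ℝ → ℝ) (Ω : Set (ℝ × ℝ)) (u : ℝ × ℝ → ℝ) : Prop :=
  IsSolution k p ε q Ω u ∧ MemH k Ω u ∧ Ieps k p ε q Ω u = ceps k p q Ω ε

/-- The vortex core `A_ε = {x ∈ Ω : u(x) > q(x) ln(1/ε)}`. -/
def vcore (q : ℝ × ℝ → ℝ) (Ω : Set (ℝ × ℝ)) (ε : ℝ) (u : ℝ × ℝ → ℝ) : Set (ℝ × ℝ) :=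
  {x ∈ Ω | q x * Real.log (1 / ε) < u x}

lemma pPart_nonneg (s : ℝ) : 0 ≤ pPart s := le_max_right _ _

lemma pPart_of_pos {s : ℝ} (h : 0 < s) : pPart s = s := max_eq_left h.le

lemma pPart_of_nonpos {s : ℝ} (h : s ≤ 0) : pPart s = 0 := max_eq_right h

lemma continuous_pPart : Continuous pPart := continuous_id.max continuous_const

lemma hasDerivAt_pPart_rpow {a : ℝ} (ha : 1 < a) (s : ℝ) :
    HasDerivAt (fun s => pPart s ^ a) (a * pPart s ^ (a - 1)) s := by
  rcases lt_trichotomy s 0 with h | h | h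
  · have e : (fun s => pPart s ^ a) =ᶠ[𝓝 s] fun _ => 0 := by
      filter_upwards [eventually_lt_nhds h] with y hy
      rw [pPart_of_nonpos hy.le, Real.zero_rpow (by linarith)]
    rw [pPart_of_nonpos h.le, Real.zero_rpow (by linarith), mul_zero]
    exact (hasDerivAt_const s (0:ℝ)).congr_of_eventuallyEq e
  · subst h
    have h0 := hasDerivAt_abs_rpow 0 ha
    rw [mul_zero, hasDerivAt_iff_isLittleO] at h0
    rw [pPart_of_nonpos le_rfl, Real.zero_rpow (by linarith), mul_zero, hasDerivAt_iff_isLittleO]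
    refine Asymptotics.IsBigO.trans_isLittleO ?_ h0
    refine Asymptotics.IsBigO.of_bound 1 (Eventually.of_forall fun y => ?_)
    simp only [pPart_of_nonpos le_rfl, abs_zero, smul_zero, sub_zero, one_mul,
      Real.zero_rpow (show a ≠ 0 by linarith)]
    rw [Real.norm_of_nonneg (Real.rpow_nonneg (pPart_nonneg _) _),
      Real.norm_of_nonneg (Real.rpow_nonneg (abs_nonneg _) _)]
    exact Real.rpow_le_rpow (pPart_nonneg _) (max_le (le_abs_self y) (abs_nonneg y)) (by linarith)
  · have e : (fun s => pPart s ^ a) =ᶠ[𝓝 s] fun s => s ^ a := by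
      filter_upwards [eventually_gt_nhds h] with y hy
      rw [pPart_of_pos hy]
    rw [pPart_of_pos h]
    exact (Real.hasDerivAt_rpow_const (Or.inl h.ne')).congr_of_eventuallyEq e

lemma continuous_pPart_rpow {a : ℝ} (ha : 0 ≤ a) : Continuous (fun s => pPart s ^ a) :=
  continuous_pPart.rpow_const fun _ => Or.inr ha

lemma contDiff_pPart_rpow {a : ℝ} (ha : 1 < a) : ContDiff ℝ 1 (fun s => pPart s ^ a) := by
  rw [contDiff_one_iff_deriv]
  refine ⟨fun s => (hasDerivAt_pPart_rpow ha s).differentiableAt, ?_⟩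
  have : deriv (fun s => pPart s ^ a) = fun s => a * pPart s ^ (a - 1) :=
    funext fun s => (hasDerivAt_pPart_rpow ha s).deriv
  rw [this]
  exact continuous_const.mul (continuous_pPart_rpow (by linarith))

/-- The compact set where `v ≥ 0`. -/
def Kc (Ω : Set (ℝ × ℝ)) (v : ℝ × ℝ → ℝ) : Set (ℝ × ℝ) := closure Ω ∩ {x | 0 ≤ v x}

structure Adm (Ω : Set (ℝ × ℝ)) (v : ℝ × ℝ → ℝ) : Prop where
  op : IsOpen Ω
  bd : Bornology.IsBounded Ω
  cont : ContinuousOn v (closure Ω)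
  fr : ∀ x ∈ frontier Ω, v x < 0
  c1 : ContDiffOn ℝ 1 v Ω

lemma Adm.compact {Ω : Set (ℝ × ℝ)} {v : ℝ × ℝ → ℝ} (h : Adm Ω v) : IsCompact (Kc Ω v) := by
  have hc : IsCompact (closure Ω) := h.bd.isCompact_closure
  refine hc.of_isClosed_subset ?_ inter_subset_left
  exact h.cont.preimage_isClosed_of_isClosed isClosed_closure isClosed_Ici

lemma Adm.subset {Ω : Set (ℝ × ℝ)} {v : ℝ × ℝ → ℝ} (h : Adm Ω v) : Kc Ω v ⊆ Ω := by
  rintro x ⟨hx, hv⟩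
  by_contra hn
  have : x ∈ frontier Ω := by
    rw [frontier, h.op.interior_eq]; exact ⟨hx, hn⟩
  exact absurd (h.fr x this) (not_lt.mpr hv)

/-- Extension by zero of `v₊ᵃ H`. -/
def ext0 (Ω : Set (ℝ × ℝ)) (v : ℝ × ℝ → ℝ) (a : ℝ) (H : ℝ × ℝ → ℝ) : ℝ × ℝ → ℝ :=
  Ω.indicator (fun x => pPart (v x) ^ a * H x)

section ext
variable {Ω : Set (ℝ × ℝ)} {v H : ℝ × ℝ → ℝ} {a : ℝ}

lemma ext0_zero (ha : 0 < a) {x : ℝ × ℝ} (hx : x ∉ Kc Ω v) : ext0 Ω v a H x = 0 := by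
  unfold ext0
  by_cases hΩ : x ∈ Ω
  · rw [indicator_of_mem hΩ]
    have : v x < 0 := by
      by_contra hn
      exact hx ⟨subset_closure hΩ, not_lt.mp hn⟩
    rw [pPart_of_nonpos this.le, Real.zero_rpow ha.ne', zero_mul]
  · rw [indicator_of_notMem hΩ]

lemma ext0_tsupport (h : Adm Ω v) (ha : 0 < a) : tsupport (ext0 Ω v a H) ⊆ Kc Ω v := by
  refine closure_minimal ?_ h.compact.isClosed
  intro x hx
  by_contra hn
  exact hx (ext0_zero ha hn)

lemma ext0_compactSupport (h : Adm Ω v) (ha : 0 < a) : HasCompactSupport (ext0 Ω v a H) :=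
  h.compact.of_isClosed_subset (isClosed_tsupport _) (ext0_tsupport h ha)

lemma ext0_eventuallyEq (h : Adm Ω v) {x : ℝ × ℝ} (hx : x ∈ Ω) :
    ext0 Ω v a H =ᶠ[𝓝 x] fun x => pPart (v x) ^ a * H x := by
  filter_upwards [h.op.mem_nhds hx] with y hy
  exact indicator_of_mem hy _

lemma ext0_contDiff (h : Adm Ω v) (ha : 1 < a) (hH : ContDiffOn ℝ 1 H Ω) :
    ContDiff ℝ 1 (ext0 Ω v a H) := by
  rw [contDiff_iff_contDiffAt]
  intro x
  by_cases hx : x ∈ Ω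
  · refine ContDiffAt.congr_of_eventuallyEq ?_ (ext0_eventuallyEq h hx)
    have h1 := (h.c1.contDiffAt (h.op.mem_nhds hx))
    exact ((contDiff_pPart_rpow ha).contDiffAt.comp x h1).mul (hH.contDiffAt (h.op.mem_nhds hx))
  · have : x ∉ tsupport (ext0 Ω v a H) := fun hn =>
      hx (h.subset (ext0_tsupport h (by linarith) hn))
    have e : ext0 Ω v a H =ᶠ[𝓝 x] fun _ => 0 := notMem_tsupport_iff_eventuallyEq.mp this
    exact contDiffAt_const.congr_of_eventuallyEq e

lemma ext0_fderiv_zero (h : Adm Ω v) (ha : 0 < a) {x : ℝ × ℝ} (hx : x ∉ Kc Ω v) :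
    fderiv ℝ (ext0 Ω v a H) x = 0 := by
  have : x ∉ tsupport (ext0 Ω v a H) := fun hn => hx (ext0_tsupport h ha hn)
  have e : ext0 Ω v a H =ᶠ[𝓝 x] fun _ => 0 := notMem_tsupport_iff_eventuallyEq.mp this
  rw [e.fderiv_eq]; simp

lemma ext0_fderiv (h : Adm Ω v) (ha : 1 < a) (hH : ContDiffOn ℝ 1 H Ω) {x : ℝ × ℝ} (hx : x ∈ Ω)
    (e : ℝ × ℝ) :
    fderiv ℝ (ext0 Ω v a H) x e = pPart (v x) ^ a * fderiv ℝ H x e +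
      a * pPart (v x) ^ (a - 1) * fderiv ℝ v x e * H x := by
  rw [(ext0_eventuallyEq h hx).fderiv_eq]
  have h1 := (h.c1.contDiffAt (h.op.mem_nhds hx)).differentiableAt one_ne_zero
  have h2 := (hH.contDiffAt (h.op.mem_nhds hx)).differentiableAt one_ne_zero
  have h3 := (hasDerivAt_pPart_rpow ha (v x)).comp_hasFDerivAt x h1.hasFDerivAt
  have h4 := h3.mul h2.hasFDerivAt
  have := h4.fderiv
  simp only [Function.comp_def] at this
  erw [this]
  simp
  ring

lemma integral_fderiv_zero {G : ℝ × ℝ → ℝ} (hG : ContDiff ℝ 1 G) (hc : HasCompactSupport G)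
    (e : ℝ × ℝ) : ∫ x, fderiv ℝ G x e = 0 := by
  have hcont : Continuous (fun x => fderiv ℝ G x e) :=
    (hG.continuous_fderiv one_ne_zero).clm_apply continuous_const
  have hcs : HasCompactSupport (fun x => fderiv ℝ G x e) := hc.fderiv_apply ℝ e
  have := integral_mul_fderiv_eq_neg_fderiv_mul_of_integrable (μ := volume) (f := G)
    (g := fun _ => (1:ℝ)) (v := e) (by simpa using hcont.integrable_of_hasCompactSupport hcs)
    (by simp) (by simpa using hG.continuous.integrable_of_hasCompactSupport hc)
    (fun x _ => (hG.differentiable one_ne_zero) x) (fun x _ => by fun_prop)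
  simp at this
  exact this

end ext

lemma KHform_vec (k : ℝ) (x a b : ℝ × ℝ) :
    KHform k x a b = (KHvec k x a).1 * b.1 + (KHvec k x a).2 * b.2 := by
  unfold KHform KHvec; ring

lemma den_pos {k : ℝ} (hk : 0 < k) (x : ℝ × ℝ) : 0 < k ^ 2 + x.1 ^ 2 + x.2 ^ 2 := by positivity

lemma KHform_self {k : ℝ} (hk : 0 < k) (x a : ℝ × ℝ) :
    KHform k x a a = (k ^ 2 * (a.1 ^ 2 + a.2 ^ 2) + (x.2 * a.1 - x.1 * a.2) ^ 2) /
      (k ^ 2 + x.1 ^ 2 + x.2 ^ 2) := by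
  have := den_pos hk x
  unfold KHform; field_simp; ring

lemma KHform_nonneg {k : ℝ} (hk : 0 < k) (x a : ℝ × ℝ) : 0 ≤ KHform k x a a := by
  rw [KHform_self hk]; have := den_pos hk x; positivity

lemma KHform_le {k : ℝ} (hk : 0 < k) (x a : ℝ × ℝ) : KHform k x a a ≤ a.1 ^ 2 + a.2 ^ 2 := by
  rw [KHform_self hk, div_le_iff₀ (den_pos hk x)]
  nlinarith [sq_nonneg (x.1 * a.1 + x.2 * a.2)]

lemma le_KHform {k : ℝ} (hk : 0 < k) (x a : ℝ × ℝ) :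
    k ^ 2 * (a.1 ^ 2 + a.2 ^ 2) ≤ (k ^ 2 + x.1 ^ 2 + x.2 ^ 2) * KHform k x a a := by
  rw [KHform_self hk, mul_div_cancel₀ _ (den_pos hk x).ne']
  nlinarith [sq_nonneg (x.2 * a.1 - x.1 * a.2)]

section contd
variable {Ω : Set (ℝ × ℝ)} {v : ℝ × ℝ → ℝ} {k : ℝ}

lemma contDiffOn_fderiv_apply (hΩ : IsOpen Ω) (h2 : ContDiffOn ℝ 2 v Ω) (e : ℝ × ℝ) :
    ContDiffOn ℝ 1 (fun x => fderiv ℝ v x e) Ω :=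
  (h2.fderiv_of_isOpen hΩ (by norm_num)).clm_apply contDiffOn_const

lemma contDiff_coef (hk : 0 < k) : ContDiff ℝ 1 (fun x : ℝ × ℝ => (k ^ 2 + x.1 ^ 2 + x.2 ^ 2)⁻¹) :=
  ContDiff.inv (by fun_prop) fun x => (den_pos hk x).ne'

lemma contDiffOn_vec1 (hk : 0 < k) (hΩ : IsOpen Ω) (h2 : ContDiffOn ℝ 2 v Ω) :
    ContDiffOn ℝ 1 (fun x => (KHvec k x (grad v x)).1) Ω := by
  have h10 := contDiffOn_fderiv_apply hΩ h2 (1,0)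
  have h01 := contDiffOn_fderiv_apply hΩ h2 (0,1)
  unfold KHvec grad
  refine (contDiff_coef hk).contDiffOn.mul (ContDiffOn.sub (ContDiffOn.mul ?_ h10)
    (ContDiffOn.mul ?_ h01)) <;> exact ContDiff.contDiffOn (by fun_prop)

lemma contDiffOn_vec2 (hk : 0 < k) (hΩ : IsOpen Ω) (h2 : ContDiffOn ℝ 2 v Ω) :
    ContDiffOn ℝ 1 (fun x => (KHvec k x (grad v x)).2) Ω := by
  have h10 := contDiffOn_fderiv_apply hΩ h2 (1,0)
  have h01 := contDiffOn_fderiv_apply hΩ h2 (0,1)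
  unfold KHvec grad
  refine (contDiff_coef hk).contDiffOn.mul (ContDiffOn.add (ContDiffOn.mul ?_ h10)
    (ContDiffOn.mul ?_ h01)) <;> exact ContDiff.contDiffOn (by fun_prop)

lemma continuousOn_form (hk : 0 < k) (hΩ : IsOpen Ω) (h2 : ContDiffOn ℝ 2 v Ω) :
    ContinuousOn (fun x => KHform k x (grad v x) (grad v x)) Ω := by
  simp only [KHform_vec]
  exact ((contDiffOn_vec1 hk hΩ h2).continuousOn.mul
    (contDiffOn_fderiv_apply hΩ h2 (1,0)).continuousOn).add
    ((contDiffOn_vec2 hk hΩ h2).continuousOn.mul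
    (contDiffOn_fderiv_apply hΩ h2 (0,1)).continuousOn)

lemma test_identity (hk : 0 < k) (h : Adm Ω v) (h2 : ContDiffOn ℝ 2 v Ω) {a : ℝ} (ha : 1 < a)
    {f : ℝ × ℝ → ℝ} (hf : ContinuousOn f Ω) (hL : ∀ x ∈ Ω, LH k v x = f x) :
    ∫ x in Kc Ω v, a * pPart (v x) ^ (a - 1) * KHform k x (grad v x) (grad v x) =
      ∫ x in Kc Ω v, f x * pPart (v x) ^ a := by
  set H1 := fun x => (KHvec k x (grad v x)).1
  set H2 := fun x => (KHvec k x (grad v x)).2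
  have c1 : ContDiffOn ℝ 1 H1 Ω := contDiffOn_vec1 hk h.op h2
  have c2 : ContDiffOn ℝ 1 H2 Ω := contDiffOn_vec2 hk h.op h2
  have d1 := ext0_contDiff h ha c1
  have d2 := ext0_contDiff h ha c2
  have s1 := ext0_compactSupport (H := H1) h (by linarith : 0 < a)
  have s2 := ext0_compactSupport (H := H2) h (by linarith : 0 < a)
  have i1 : Integrable (fun x => fderiv ℝ (ext0 Ω v a H1) x (1,0)) :=
    ((d1.continuous_fderiv one_ne_zero).clm_apply continuous_const).integrable_of_hasCompactSupport
      (s1.fderiv_apply ℝ _)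
  have i2 : Integrable (fun x => fderiv ℝ (ext0 Ω v a H2) x (0,1)) :=
    ((d2.continuous_fderiv one_ne_zero).clm_apply continuous_const).integrable_of_hasCompactSupport
      (s2.fderiv_apply ℝ _)
  have e0 : ∫ x, (fderiv ℝ (ext0 Ω v a H1) x (1,0) + fderiv ℝ (ext0 Ω v a H2) x (0,1)) = 0 := by
    rw [integral_add i1 i2, integral_fderiv_zero d1 s1, integral_fderiv_zero d2 s2, add_zero]
  rw [← setIntegral_eq_integral_of_forall_compl_eq_zero (s := Kc Ω v) (by
    intro x hx
    rw [ext0_fderiv_zero h (by linarith) hx, ext0_fderiv_zero h (by linarith) hx]; simp)] at e0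
  have hv : ContinuousOn v (Kc Ω v) := h.cont.mono inter_subset_left
  have j1 : IntegrableOn (fun x => a * pPart (v x) ^ (a - 1) * KHform k x (grad v x) (grad v x))
      (Kc Ω v) := by
    refine ContinuousOn.integrableOn_compact h.compact ?_
    exact (continuousOn_const.mul ((continuous_pPart_rpow (by linarith)).comp_continuousOn hv)).mul
      ((continuousOn_form hk h.op h2).mono h.subset)
  have j2 : IntegrableOn (fun x => f x * pPart (v x) ^ a) (Kc Ω v) := by
    refine ContinuousOn.integrableOn_compact h.compact ?_
    exact (hf.mono h.subset).mul ((continuous_pPart_rpow (by linarith)).comp_continuousOn hv)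
  rw [← sub_eq_zero, ← integral_sub j1 j2, ← e0]
  refine setIntegral_congr_fun h.compact.measurableSet ?_
  intro x hx
  have hxΩ := h.subset hx
  have hl := hL x hxΩ
  simp only
  rw [ext0_fderiv h ha c1 hxΩ, ext0_fderiv h ha c2 hxΩ, KHform_vec, ← hl, LH, div2]
  simp only [H1, H2, grad]
  ring

lemma test_limit (hk : 0 < k) (h : Adm Ω v) (h2 : ContDiffOn ℝ 2 v Ω)
    {f : ℝ × ℝ → ℝ} (hf : ContinuousOn f Ω) (hL : ∀ x ∈ Ω, LH k v x = f x) :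
    ∫ x in {x ∈ Ω | 0 < v x}, KHform k x (grad v x) (grad v x) =
      ∫ x in Kc Ω v, f x * pPart (v x) := by
  have hv : ContinuousOn v (Kc Ω v) := h.cont.mono inter_subset_left
  have hF : ContinuousOn (fun x => KHform k x (grad v x) (grad v x)) (Kc Ω v) :=
    (continuousOn_form hk h.op h2).mono h.subset
  have hf' := hf.mono h.subset
  have hmK := h.compact.measurableSet
  obtain ⟨B, hB⟩ := h.compact.exists_bound_of_continuousOn hv
  obtain ⟨D, hD⟩ := h.compact.exists_bound_of_continuousOn hF
  obtain ⟨E, hE⟩ := h.compact.exists_bound_of_continuousOn hf'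
  have hopen : IsOpen {x ∈ Ω | 0 < v x} := by
    have : ContinuousOn v Ω := h.cont.mono subset_closure
    exact this.isOpen_inter_preimage h.op isOpen_Ioi
  have hsub : {x ∈ Ω | 0 < v x} ⊆ Kc Ω v := fun x hx => ⟨subset_closure hx.1, hx.2.le⟩
  set M := max B 1
  have hM1 : 1 ≤ M := le_max_right _ _
  have hpM : ∀ x ∈ Kc Ω v, pPart (v x) ≤ M := fun x hx =>
    max_le ((le_abs_self _).trans ((hB x hx).trans (le_max_left _ _))) (by linarith)
  have hfin : volume (Kc Ω v) ≠ ⊤ := h.compact.measure_lt_top.ne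
  let α : ℕ → ℝ := fun n => 1 / ((n:ℝ) + 1)
  have hα0 : ∀ n, 0 < α n := fun n => Nat.one_div_pos_of_nat
  have hα1 : ∀ n, α n ≤ 1 := fun n => by
    simp only [α]; rw [div_le_one (by positivity)]; linarith [n.cast_nonneg (α := ℝ)]
  have hαt : Tendsto α atTop (𝓝 0) := tendsto_one_div_add_atTop_nhds_zero_nat
  have hpow : ∀ x ∈ Kc Ω v, ∀ b : ℝ, 0 ≤ b → b ≤ 2 → |pPart (v x) ^ b| ≤ M ^ (2:ℝ) := by
    intro x hx b hb0 hb2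
    rw [abs_of_nonneg (Real.rpow_nonneg (pPart_nonneg _) _)]
    exact (Real.rpow_le_rpow (pPart_nonneg _) (hpM x hx) hb0).trans
      (Real.rpow_le_rpow_of_exponent_le hM1 hb2)
  have T1 : Tendsto (fun n => ∫ x in Kc Ω v, (1 + α n) * pPart (v x) ^ (1 + α n - 1) *
      KHform k x (grad v x) (grad v x)) atTop (𝓝 (∫ x in Kc Ω v,
        ({x ∈ Ω | 0 < v x}).indicator (fun x => KHform k x (grad v x) (grad v x)) x)) := by
    refine tendsto_integral_of_dominated_convergence (fun _ => 2 * M ^ (2:ℝ) * D) ?_ ?_ ?_ ?_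
    · intro n
      refine ContinuousOn.aestronglyMeasurable ?_ hmK
      exact (continuousOn_const.mul ((continuous_pPart_rpow
        (by linarith [hα0 n])).comp_continuousOn hv)).mul hF
    · exact integrableOn_const hfin
    · intro n
      refine (ae_restrict_iff' hmK).mpr (Eventually.of_forall fun x hx => ?_)
      rw [norm_mul, norm_mul]
      have a1 : ‖1 + α n‖ ≤ 2 := by
        rw [Real.norm_of_nonneg (by linarith [hα0 n])]; linarith [hα1 n]
      have a2 : ‖pPart (v x) ^ (1 + α n - 1)‖ ≤ M ^ (2:ℝ) :=
        hpow x hx _ (by linarith [hα0 n]) (by linarith [hα1 n])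
      have a3 := hD x hx
      gcongr
    · refine (ae_restrict_iff' hmK).mpr (Eventually.of_forall fun x hx => ?_)
      by_cases hx0 : 0 < v x
      · rw [indicator_of_mem (show x ∈ {x ∈ Ω | 0 < v x} from ⟨h.subset hx, hx0⟩)]
        have t1 : Tendsto (fun n => 1 + α n) atTop (𝓝 1) := by simpa using hαt.const_add 1
        have t2 : Tendsto (fun n => pPart (v x) ^ (1 + α n - 1)) atTop (𝓝 1) := by
          have : Tendsto (fun n => pPart (v x) ^ (α n)) atTop (𝓝 (pPart (v x) ^ (0:ℝ))) :=
            tendsto_const_nhds.rpow hαt (Or.inl (by rw [pPart_of_pos hx0]; exact hx0.ne'))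
          simpa using this
        simpa using (t1.mul t2).mul_const (KHform k x (grad v x) (grad v x))
      · rw [indicator_of_notMem (fun hn => hx0 hn.2)]
        have : ∀ n, (1 + α n) * pPart (v x) ^ (1 + α n - 1) *
            KHform k x (grad v x) (grad v x) = 0 := fun n => by
          rw [pPart_of_nonpos (not_lt.mp hx0), Real.zero_rpow (by linarith [hα0 n])]; ring
        simp only [this]; exact tendsto_const_nhds
  have T2 : Tendsto (fun n => ∫ x in Kc Ω v, f x * pPart (v x) ^ (1 + α n)) atTop
      (𝓝 (∫ x in Kc Ω v, f x * pPart (v x))) := by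
    refine tendsto_integral_of_dominated_convergence (fun _ => E * M ^ (2:ℝ)) ?_ ?_ ?_ ?_
    · intro n
      refine ContinuousOn.aestronglyMeasurable ?_ hmK
      exact hf'.mul ((continuous_pPart_rpow (by linarith [hα0 n])).comp_continuousOn hv)
    · exact integrableOn_const hfin
    · intro n
      refine (ae_restrict_iff' hmK).mpr (Eventually.of_forall fun x hx => ?_)
      rw [norm_mul]
      have a2 : ‖pPart (v x) ^ (1 + α n)‖ ≤ M ^ (2:ℝ) :=
        hpow x hx _ (by linarith [hα0 n]) (by linarith [hα1 n])
      have a3 := hE x hx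
      have := (norm_nonneg _).trans a3
      gcongr
    · refine Eventually.of_forall fun x => ?_
      have t1 : Tendsto (fun n => 1 + α n) atTop (𝓝 1) := by simpa using hαt.const_add 1
      have : Tendsto (fun n => pPart (v x) ^ (1 + α n)) atTop (𝓝 (pPart (v x) ^ (1:ℝ))) :=
        tendsto_const_nhds.rpow t1 (Or.inr one_pos)
      rw [Real.rpow_one] at this
      exact this.const_mul _
  have heq : ∀ n, (∫ x in Kc Ω v, (1 + α n) * pPart (v x) ^ (1 + α n - 1) *
      KHform k x (grad v x) (grad v x)) = ∫ x in Kc Ω v, f x * pPart (v x) ^ (1 + α n) :=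
    fun n => test_identity hk h h2 (by linarith [hα0 n]) hf hL
  simp only [heq] at T1
  have := tendsto_nhds_unique T1 T2
  rw [← this, setIntegral_indicator hopen.measurableSet, inter_eq_right.mpr hsub]

end contd
lemma cs_integral {μ : Measure (ℝ × ℝ)} {f g : ℝ × ℝ → ℝ} (hf : Integrable (fun x => f x ^ 2) μ)
    (hg : Integrable (fun x => g x ^ 2) μ) (hfg : Integrable (fun x => f x * g x) μ) :
    (∫ x, f x * g x ∂μ) ^ 2 ≤ (∫ x, f x ^ 2 ∂μ) * ∫ x, g x ^ 2 ∂μ := by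
  have := discrim_le_zero (a := ∫ x, f x ^ 2 ∂μ) (b := 2 * ∫ x, f x * g x ∂μ)
    (c := ∫ x, g x ^ 2 ∂μ) (by
      intro s
      have : 0 ≤ ∫ x, (s * s * f x ^ 2 + 2 * s * (f x * g x)) + g x ^ 2 ∂μ :=
        integral_nonneg fun x => by
          have : (s * s * f x ^ 2 + 2 * s * (f x * g x)) + g x ^ 2 = (s * f x + g x) ^ 2 := by ring
          simp only [this]; positivity
      have ii : Integrable (fun x => s * s * f x ^ 2 + 2 * s * (f x * g x)) μ :=
        (hf.const_mul _).add (hfg.const_mul _)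
      rw [integral_add ii hg,
        integral_add (hf.const_mul _) (hfg.const_mul _), integral_const_mul,
        integral_const_mul] at this
      linarith)
  unfold discrim at this
  nlinarith

lemma sobolev_one : ∃ C : ℝ, 0 ≤ C ∧ ∀ g : ℝ × ℝ → ℝ, ContDiff ℝ 1 g → HasCompactSupport g →
    ∫ x, g x ^ 2 ≤ C * (∫ x, ‖fderiv ℝ g x‖) ^ 2 := by
  refine ⟨(lintegralPowLePowLIntegralFDerivConst (volume : Measure (ℝ × ℝ)) 2 : ℝ),
    NNReal.coe_nonneg _, fun g hg hc => ?_⟩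
  have hr : Module.finrank ℝ (ℝ × ℝ) = 2 := by simp
  have h := lintegral_pow_le_pow_lintegral_fderiv (volume : Measure (ℝ × ℝ)) hg hc (p := 2)
    (by rw [hr]; exact_mod_cast Real.HolderConjugate.two_two)
  have i1 : Integrable (fun x => g x ^ 2) := by
    have hs : HasCompactSupport (fun x => g x ^ 2) := by
      refine HasCompactSupport.intro hc fun x hx => ?_
      rw [image_eq_zero_of_notMem_tsupport hx]; norm_num
    exact (hg.continuous.pow 2).integrable_of_hasCompactSupport hs
  have i2 : Integrable (fun x => fderiv ℝ g x) :=
    (hg.continuous_fderiv one_ne_zero).integrable_of_hasCompactSupport (hc.fderiv ℝ)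
  have e1 : ∫⁻ x, ‖g x‖ₑ ^ (2:ℝ) = ENNReal.ofReal (∫ x, g x ^ 2) := by
    rw [ofReal_integral_eq_lintegral_ofReal i1 (Eventually.of_forall fun x => sq_nonneg _)]
    refine lintegral_congr fun x => ?_
    rw [← ofReal_norm, ENNReal.ofReal_rpow_of_nonneg (norm_nonneg _) (by norm_num)]
    norm_num
  rw [e1, ← ofReal_integral_norm_eq_lintegral_enorm i2,
    ENNReal.ofReal_rpow_of_nonneg (integral_nonneg fun _ => norm_nonneg _) (by norm_num),
    ← ENNReal.ofReal_coe_nnreal, ← ENNReal.ofReal_mul (NNReal.coe_nonneg _)] at h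
  rw [ENNReal.ofReal_le_ofReal_iff (by positivity)] at h
  norm_num at h
  exact h

lemma norm_clm_le (T : ℝ × ℝ →L[ℝ] ℝ) : ‖T‖ ≤ |T (1,0)| + |T (0,1)| := by
  refine T.opNorm_le_bound (by positivity) fun x => ?_
  have : x = x.1 • ((1:ℝ),(0:ℝ)) + x.2 • ((0:ℝ),(1:ℝ)) := by ext <;> simp
  calc ‖T x‖ = ‖x.1 * T (1,0) + x.2 * T (0,1)‖ := by
        conv_lhs => rw [this]
        rw [map_add, map_smul, map_smul]; rfl
    _ ≤ |x.1| * |T (1,0)| + |x.2| * |T (0,1)| := by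
        rw [← abs_mul, ← abs_mul]; exact abs_add_le _ _
    _ ≤ ‖x‖ * |T (1,0)| + ‖x‖ * |T (0,1)| := by
        gcongr
        · exact norm_fst_le x
        · exact norm_snd_le x
    _ = _ := by ring

section core
variable {Ω : Set (ℝ × ℝ)} {v : ℝ × ℝ → ℝ} {k : ℝ}

lemma gn_ineq {p k R : ℝ} (hp : 1 < p) (hk : 0 < k) : ∃ C : ℝ, 0 ≤ C ∧
    ∀ (Ω : Set (ℝ × ℝ)) (v : ℝ × ℝ → ℝ), (∀ x ∈ Ω, k ^ 2 + x.1 ^ 2 + x.2 ^ 2 ≤ R) →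
      Adm Ω v → ContDiffOn ℝ 2 v Ω →
      ∫ x in Kc Ω v, pPart (v x) ^ (p + 2) ≤ C * (∫ x in Kc Ω v, pPart (v x) ^ p) *
        ∫ x in {x ∈ Ω | 0 < v x}, KHform k x (grad v x) (grad v x) := by
  obtain ⟨C, hC0, hC⟩ := sobolev_one
  refine ⟨C * ((p + 2) / 2) ^ 2 * (2 * |R| / k ^ 2), by positivity, fun Ω v hR h h2 => ?_⟩
  set b := (p + 2) / 2 with hb
  have hb1 : 1 < b := by rw [hb]; linarith
  set g := ext0 Ω v b (fun _ => 1)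
  have hgc : ContDiff ℝ 1 g := ext0_contDiff h hb1 contDiffOn_const
  have hgs : HasCompactSupport g := ext0_compactSupport h (by linarith)
  have hmain := hC g hgc hgs
  have hv : ContinuousOn v (Kc Ω v) := h.cont.mono inter_subset_left
  have hF : ContinuousOn (fun x => KHform k x (grad v x) (grad v x)) (Kc Ω v) :=
    (continuousOn_form hk h.op h2).mono h.subset
  have hmK := h.compact.measurableSet
  have hopen : IsOpen {x ∈ Ω | 0 < v x} := by
    have : ContinuousOn v Ω := h.cont.mono subset_closure
    exact this.isOpen_inter_preimage h.op isOpen_Ioi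
  have hsub : {x ∈ Ω | 0 < v x} ⊆ Kc Ω v := fun x hx => ⟨subset_closure hx.1, hx.2.le⟩
  have L1 : ∫ x, g x ^ 2 = ∫ x in Kc Ω v, pPart (v x) ^ (p + 2) := by
    rw [← setIntegral_eq_integral_of_forall_compl_eq_zero (s := Kc Ω v)
      (fun x hx => by simp only [g]; rw [ext0_zero (by linarith) hx]; norm_num)]
    refine setIntegral_congr_fun hmK fun x hx => ?_
    simp only [g, ext0]
    rw [indicator_of_mem (h.subset hx), mul_one, ← Real.rpow_natCast, ← Real.rpow_mul (pPart_nonneg _)]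
    congr 1; rw [hb]; push_cast; ring
  set w : ℝ × ℝ → ℝ := fun x => |fderiv ℝ v x (1,0)| + |fderiv ℝ v x (0,1)|
  have hw : ContinuousOn w (Kc Ω v) :=
    ((contDiffOn_fderiv_apply h.op h2 (1,0)).continuousOn.abs.add
      (contDiffOn_fderiv_apply h.op h2 (0,1)).continuousOn.abs).mono h.subset
  set wi : ℝ × ℝ → ℝ := ({x ∈ Ω | 0 < v x}).indicator w
  have hpp : ∀ c : ℝ, 0 < c → ∀ x ∈ Kc Ω v, pPart (v x) ^ c * wi x = pPart (v x) ^ c * w x := by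
    intro c hc x hx
    by_cases hx0 : 0 < v x
    · simp only [wi]
      rw [indicator_of_mem (show x ∈ {x ∈ Ω | 0 < v x} from ⟨h.subset hx, hx0⟩)]
    · rw [pPart_of_nonpos (not_lt.mp hx0), Real.zero_rpow hc.ne']; simp
  have L2 : ∫ x, ‖fderiv ℝ g x‖ ≤ ∫ x in Kc Ω v, b * (pPart (v x) ^ (p / 2) * wi x) := by
    rw [← setIntegral_eq_integral_of_forall_compl_eq_zero (s := Kc Ω v)
      (fun x hx => by simp only [g]; rw [ext0_fderiv_zero h (by linarith) hx]; norm_num)]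
    refine setIntegral_mono_on ?_ ?_ hmK ?_
    · exact ((hgc.continuous_fderiv one_ne_zero).norm.continuousOn).integrableOn_compact h.compact
    · have : IntegrableOn (fun x => b * (pPart (v x) ^ (p / 2) * w x)) (Kc Ω v) := by
        refine ContinuousOn.integrableOn_compact h.compact ?_
        exact continuousOn_const.mul (((continuous_pPart_rpow
          (by linarith)).comp_continuousOn hv).mul hw)
      refine this.congr_fun (fun x hx => ?_) hmK
      simp only; rw [hpp _ (by linarith) x hx]
    · intro x hx
      rw [hpp _ (by linarith) x hx]
      refine (norm_clm_le _).trans (le_of_eq ?_)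
      simp only [g]
      rw [ext0_fderiv h hb1 contDiffOn_const (h.subset hx),
        ext0_fderiv h hb1 contDiffOn_const (h.subset hx)]
      have e : b - 1 = p / 2 := by rw [hb]; ring
      have hpos : 0 ≤ b * pPart (v x) ^ (p / 2) :=
        mul_nonneg (by linarith) (Real.rpow_nonneg (pPart_nonneg _) _)
      simp only [e, w, fderiv_fun_const, Pi.zero_apply, _root_.zero_apply, mul_zero,
        zero_add, mul_one]
      rw [abs_mul, abs_mul (b * _), abs_of_nonneg hpos]; ring
  have sqp : ∀ x, (pPart (v x) ^ (p / 2)) ^ 2 = pPart (v x) ^ p := fun x => by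
    rw [← Real.rpow_natCast, ← Real.rpow_mul (pPart_nonneg _)]; congr 1; push_cast; ring
  have wi2 : (fun x => wi x ^ 2) = ({x ∈ Ω | 0 < v x}).indicator (fun x => w x ^ 2) := by
    funext x; simp only [wi, indicator]; split_ifs <;> simp
  have L3 : (∫ x in Kc Ω v, pPart (v x) ^ (p / 2) * wi x) ^ 2 ≤
      (∫ x in Kc Ω v, (pPart (v x) ^ (p/2)) ^ 2) * ∫ x in Kc Ω v, wi x ^ 2 := by
    refine cs_integral ?_ ?_ ?_
    · simp only [sqp]
      exact ((continuous_pPart_rpow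
          (by linarith)).comp_continuousOn hv).integrableOn_compact h.compact
    · rw [wi2]
      exact ((hw.pow 2).integrableOn_compact h.compact).indicator hopen.measurableSet
    · have : IntegrableOn (fun x => (pPart (v x) ^ (p / 2) * w x)) (Kc Ω v) := by
        refine ContinuousOn.integrableOn_compact h.compact ?_
        exact (((continuous_pPart_rpow (by linarith)).comp_continuousOn hv).mul hw)
      refine this.congr_fun (fun x hx => ?_) hmK
      simp only; rw [hpp _ (by linarith) x hx]
  have L4 : ∫ x in Kc Ω v, wi x ^ 2 ≤ (2 * |R| / k ^ 2) *
      ∫ x in {x ∈ Ω | 0 < v x}, KHform k x (grad v x) (grad v x) := by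
    rw [wi2, setIntegral_indicator hopen.measurableSet, inter_eq_right.mpr hsub,
      ← integral_const_mul]
    refine setIntegral_mono_on ?_ ?_ hopen.measurableSet ?_
    · exact ((hw.pow 2).integrableOn_compact h.compact).mono_set hsub
    · exact ((hF.integrableOn_compact h.compact).mono_set hsub).const_mul _
    · intro x hx
      have a1 := le_KHform hk x (grad v x)
      have a2 := KHform_nonneg hk x (grad v x)
      have a3 : (k ^ 2 + x.1 ^ 2 + x.2 ^ 2) ≤ |R| := (hR x hx.1).trans (le_abs_self R)
      have a4 := mul_le_mul_of_nonneg_right a3 a2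
      have a5 : w x ^ 2 ≤ 2 * ((grad v x).1 ^ 2 + (grad v x).2 ^ 2) := by
        simp only [w, grad]
        rw [← sq_abs (fderiv ℝ v x (1,0)), ← sq_abs (fderiv ℝ v x (0,1))]
        nlinarith [sq_nonneg (|fderiv ℝ v x (1,0)| - |fderiv ℝ v x (0,1)|)]
      rw [div_mul_eq_mul_div, le_div_iff₀ (by positivity)]
      nlinarith [sq_nonneg k]
  rw [L1] at hmain
  rw [integral_const_mul] at L2
  simp only [sqp] at L3
  have n1 : 0 ≤ ∫ x, ‖fderiv ℝ g x‖ := integral_nonneg fun _ => norm_nonneg _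
  have n2 : 0 ≤ ∫ x in Kc Ω v, pPart (v x) ^ p :=
    integral_nonneg fun _ => Real.rpow_nonneg (pPart_nonneg _) _
  calc _ ≤ C * (∫ x, ‖fderiv ℝ g x‖) ^ 2 := hmain
    _ ≤ C * (b * ∫ x in Kc Ω v, pPart (v x) ^ (p / 2) * wi x) ^ 2 := by gcongr
    _ = C * b ^ 2 * (∫ x in Kc Ω v, pPart (v x) ^ (p / 2) * wi x) ^ 2 := by ring
    _ ≤ C * b ^ 2 * ((∫ x in Kc Ω v, pPart (v x) ^ p) * ∫ x in Kc Ω v, wi x ^ 2) := by gcongr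
    _ ≤ C * b ^ 2 * ((∫ x in Kc Ω v, pPart (v x) ^ p) * ((2 * |R| / k ^ 2) *
      ∫ x in {x ∈ Ω | 0 < v x}, KHform k x (grad v x) (grad v x))) := by gcongr
    _ = _ := by ring

lemma core_bound {p k R : ℝ} (hp : 1 < p) (hk : 0 < k) : ∃ C : ℝ, 0 ≤ C ∧
    ∀ (Ω : Set (ℝ × ℝ)) (v : ℝ × ℝ → ℝ) (s : ℝ), 0 < s →
      (∀ x ∈ Ω, k ^ 2 + x.1 ^ 2 + x.2 ^ 2 ≤ R) →
      Adm Ω v → ContDiffOn ℝ 2 v Ω → (∀ x ∈ Ω, LH k v x = s * pPart (v x) ^ p) →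
      ∫ x in {x ∈ Ω | 0 < v x}, KHform k x (grad v x) (grad v x) ≤
        C * (s * ∫ x in Kc Ω v, pPart (v x) ^ p) ^ 2 := by
  obtain ⟨C, hC0, hC⟩ := gn_ineq (R := R) hp hk
  refine ⟨C, hC0, fun Ω v s hs hR h h2 hL => ?_⟩
  have g1 := hC Ω v hR h h2
  have hv : ContinuousOn v (Kc Ω v) := h.cont.mono inter_subset_left
  have hvo : ContinuousOn v Ω := h.cont.mono subset_closure
  have t := test_limit hk h h2 (f := fun x => s * pPart (v x) ^ p)
    (continuousOn_const.mul ((continuous_pPart_rpow (by linarith)).comp_continuousOn hvo)) hL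
  have hp2 : ∀ c : ℝ, 0 ≤ c → IntegrableOn (fun x => pPart (v x) ^ c) (Kc Ω v) := fun c hc =>
    ((continuous_pPart_rpow hc).comp_continuousOn hv).integrableOn_compact h.compact
  have e1 : ∀ y, (pPart (v y) ^ (p/2)) ^ 2 = pPart (v y) ^ p := fun y => by
    rw [← Real.rpow_natCast, ← Real.rpow_mul (pPart_nonneg _)]; congr 1; push_cast; ring
  have e2 : ∀ y, (pPart (v y) ^ ((p+2)/2)) ^ 2 = pPart (v y) ^ (p+2) := fun y => by
    rw [← Real.rpow_natCast, ← Real.rpow_mul (pPart_nonneg _)]; congr 1; push_cast; ring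
  have e3 : ∀ y, pPart (v y) ^ (p/2) * pPart (v y) ^ ((p+2)/2) = pPart (v y) ^ (p+1) := fun y => by
    rw [← Real.rpow_add_of_nonneg (pPart_nonneg _) (by linarith) (by linarith)]; congr 1; ring
  have cs := cs_integral (μ := volume.restrict (Kc Ω v)) (f := fun x => pPart (v x) ^ (p / 2))
    (g := fun x => pPart (v x) ^ ((p+2) / 2))
    (by simp only [e1]; exact hp2 _ (by linarith)) (by simp only [e2]; exact hp2 _ (by linarith))
    (by simp only [e3]; exact hp2 _ (by linarith))
  simp only [e1, e2, e3] at cs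
  have e4 : ∀ y, s * pPart (v y) ^ p * pPart (v y) = s * pPart (v y) ^ (p + 1) := fun y => by
    rw [Real.rpow_add_one' (pPart_nonneg _) (by linarith)]; ring
  simp only [e4, integral_const_mul] at t
  set D := ∫ x in {x ∈ Ω | 0 < v x}, KHform k x (grad v x) (grad v x)
  set E := ∫ x in Kc Ω v, pPart (v x) ^ (p + 1)
  set M := ∫ x in Kc Ω v, pPart (v x) ^ p
  set W := ∫ x in Kc Ω v, pPart (v x) ^ (p + 2)
  have hE : 0 ≤ E := integral_nonneg fun _ => Real.rpow_nonneg (pPart_nonneg _) _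
  have hM : 0 ≤ M := integral_nonneg fun _ => Real.rpow_nonneg (pPart_nonneg _) _
  have hD : 0 ≤ D := integral_nonneg fun _ => KHform_nonneg hk _ _
  rcases hD.eq_or_lt with h0 | hpos
  · rw [← h0]; positivity
  · have : D * D ≤ D * (C * (s * M) ^ 2) := by
      calc D * D = s ^ 2 * E ^ 2 := by rw [t]; ring
        _ ≤ s ^ 2 * (M * (C * M * D)) := by gcongr; exact cs.trans (by gcongr)
        _ = _ := by ring
    exact le_of_mul_le_mul_left this hpos

end core
lemma polar_integral {R ε : ℝ} (hR : 0 < R) (hε : 0 < ε) :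
    ∫ x : ℝ × ℝ, ({x : ℝ × ℝ | x.1 ^ 2 + x.2 ^ 2 < R ^ 2}).indicator
      (fun x => 1 / (ε ^ 2 + (x.1 ^ 2 + x.2 ^ 2))) x = π * Real.log (1 + R ^ 2 / ε ^ 2) := by
  rw [← integral_comp_polarCoord_symm, polarCoord_target]
  have e : ∀ x ∈ (Ioi (0:ℝ) ×ˢ Ioo (-π) π),
      (x.1 • ({x : ℝ × ℝ | x.1 ^ 2 + x.2 ^ 2 < R ^ 2}).indicator
      (fun x => 1 / (ε ^ 2 + (x.1 ^ 2 + x.2 ^ 2))) (polarCoord.symm x)) =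
      (Iio R).indicator (fun r => r / (ε ^ 2 + r ^ 2)) x.1 * (fun _ => (1:ℝ)) x.2 := by
    rintro ⟨r, θ⟩ ⟨hr, -⟩
    have hr0 : 0 < r := hr
    have hs : (r * cos θ) ^ 2 + (r * sin θ) ^ 2 = r ^ 2 := by
      have := Real.sin_sq_add_cos_sq θ
      linear_combination r ^ 2 * this
    simp only [polarCoord_symm_apply, indicator, mem_ofPred_eq, hs, mem_Iio, smul_eq_mul, mul_one]
    have : r ^ 2 < R ^ 2 ↔ r < R := sq_lt_sq₀ hr0.le hR.le
    simp only [this]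
    split_ifs <;> ring
  rw [setIntegral_congr_fun (measurableSet_Ioi.prod measurableSet_Ioo) e, Measure.volume_eq_prod,
    setIntegral_prod_mul (Iio R |>.indicator (fun r => r / (ε ^ 2 + r ^ 2))) (fun _ => (1:ℝ)), setIntegral_indicator measurableSet_Iio, Ioi_inter_Iio,
    ← integral_Ioc_eq_integral_Ioo, ← intervalIntegral.integral_of_le hR.le]
  have hd : ∀ r ∈ uIcc 0 R, HasDerivAt (fun r => Real.log (ε ^ 2 + r ^ 2) / 2)
      (r / (ε ^ 2 + r ^ 2)) r := by
    intro r _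
    have h1 : HasDerivAt (fun r => ε ^ 2 + r ^ 2) (2 * r) r := by
      simpa using (hasDerivAt_pow 2 r).const_add (ε ^ 2)
    have := (h1.log (by positivity)).div_const 2
    have hh : r / (ε ^ 2 + r ^ 2) = 2 * r / (ε ^ 2 + r ^ 2) / 2 := by ring
    rw [hh]
    exact this
  rw [intervalIntegral.integral_eq_sub_of_hasDerivAt hd]
  · have : Real.log (1 + R ^ 2 / ε ^ 2) = Real.log (ε ^ 2 + R ^ 2) - Real.log (ε ^ 2) := by
      rw [← Real.log_div (by positivity) (by positivity)]; congr 1; field_simp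
    rw [this]
    simp [Real.volume_real_Ioo_of_le (show -π ≤ π by linarith [Real.pi_pos])]
    ring
  · refine ContinuousOn.intervalIntegrable ?_
    exact continuousOn_id.div (by fun_prop) fun r _ => by positivity

/-- squared Euclidean distance -/
def rho (c x : ℝ × ℝ) : ℝ := (x.1 - c.1) ^ 2 + (x.2 - c.2) ^ 2

lemma rho_nonneg (c x : ℝ × ℝ) : 0 ≤ rho c x := by unfold rho; positivity

lemma exists_testfn (c : ℝ × ℝ) {R ε : ℝ} (hR : 0 < R) (hε : 0 < ε) :
    ∃ φ : ℝ × ℝ → ℝ, ContDiff ℝ 1 φ ∧ (∀ x, R ^ 2 ≤ rho c x → φ x = 0) ∧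
      (2 * Real.log 2 ≤ Real.log (1 + R ^ 2 / ε ^ 2) → ∀ x, rho c x ≤ ε ^ 2 → 1 / 4 ≤ φ x) ∧
      ∀ x, (grad φ x).1 ^ 2 + (grad φ x).2 ^ 2 ≤ 16 / (Real.log (1 + R ^ 2 / ε ^ 2)) ^ 2 *
        ({x : ℝ × ℝ | x.1 ^ 2 + x.2 ^ 2 < R ^ 2}).indicator
          (fun x => 1 / (ε ^ 2 + (x.1 ^ 2 + x.2 ^ 2))) (x - c) := by
  set L := Real.log (1 + R ^ 2 / ε ^ 2) with hL
  have hLpos : 0 < L := Real.log_pos (by have : 0 < R ^ 2 / ε ^ 2 := by positivity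
                                         linarith)
  have h1 : ∀ x, 0 < 1 + rho c x / ε ^ 2 := fun x => by
    have := rho_nonneg c x
    positivity
  set ψ : ℝ × ℝ → ℝ := fun x => 1 - Real.log (1 + rho c x / ε ^ 2) / L with hψ
  have hrho : ContDiff ℝ 1 (fun x => 1 + rho c x / ε ^ 2) := by unfold rho; fun_prop
  have hψc : ContDiff ℝ 1 ψ := contDiff_const.sub ((hrho.log fun x => (h1 x).ne').div_const L)
  have hψneg : ∀ x, R ^ 2 ≤ rho c x → ψ x ≤ 0 := by
    intro x hx
    simp only [hψ, sub_nonpos]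
    rw [le_div_iff₀ hLpos, one_mul]
    exact Real.log_le_log (by positivity) (by gcongr)
  have hψle : ∀ x, ψ x ≤ 1 := fun x => by
    simp only [hψ]
    have : 0 ≤ Real.log (1 + rho c x / ε ^ 2) := Real.log_nonneg (by
      have : 0 ≤ rho c x / ε ^ 2 := div_nonneg (rho_nonneg c x) (by positivity)
      linarith)
    have := div_nonneg this hLpos.le
    linarith
  have hφd : ∀ x e, fderiv ℝ (fun x => pPart (ψ x) ^ (2:ℝ)) x e =
      2 * pPart (ψ x) * fderiv ℝ ψ x e := by
    intro x e
    have h3 := (hasDerivAt_pPart_rpow one_lt_two (ψ x)).comp_hasFDerivAt x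
      ((hψc.differentiable one_ne_zero) x).hasFDerivAt
    have := h3.fderiv
    simp only [Function.comp_def] at this
    rw [this]
    norm_num
  have hψd : ∀ x e, fderiv ℝ ψ x e =
      - (2 * (x.1 - c.1) * e.1 + 2 * (x.2 - c.2) * e.2) / ((ε ^ 2 + rho c x) * L) := by
    intro x e
    have hx1 : HasFDerivAt (fun x : ℝ × ℝ => x.1 - c.1) (ContinuousLinearMap.fst ℝ ℝ ℝ) x :=
      hasFDerivAt_fst.sub_const _
    have hx2 : HasFDerivAt (fun x : ℝ × ℝ => x.2 - c.2) (ContinuousLinearMap.snd ℝ ℝ ℝ) x :=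
      hasFDerivAt_snd.sub_const _
    have h4 := ((((((hx1.pow 2).add (hx2.pow 2)).mul_const ((ε ^ 2)⁻¹)).const_add 1).log
      (by have := (h1 x).ne'; unfold rho at this; simpa [div_eq_mul_inv] using this)).mul_const
        (L⁻¹)).const_sub 1
    have h5 : HasFDerivAt ψ _ x := h4
    rw [h5.fderiv]
    have hp : 0 < ε ^ 2 + rho c x := by have := rho_nonneg c x; positivity
    have hp' := h1 x
    have key : 1 + ((x.1 - c.1) ^ 2 + (x.2 - c.2) ^ 2) * (ε ^ 2)⁻¹ = (ε ^ 2 + rho c x) / ε ^ 2 := by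
      unfold rho; field_simp
    simp [key]
    field_simp
  refine ⟨fun x => pPart (ψ x) ^ (2:ℝ), (contDiff_pPart_rpow one_lt_two).comp hψc, ?_, ?_, ?_⟩
  · intro x hx
    simp only
    rw [pPart_of_nonpos (hψneg x hx), Real.zero_rpow (by norm_num)]
  · intro h2 x hx
    have a1 : Real.log (1 + rho c x / ε ^ 2) ≤ Real.log 2 := by
      refine Real.log_le_log (h1 x) ?_
      have : rho c x / ε ^ 2 ≤ 1 := by rw [div_le_one (by positivity)]; exact hx
      linarith
    have a2 : 1 / 2 ≤ ψ x := by
      simp only [hψ]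
      have : Real.log (1 + rho c x / ε ^ 2) / L ≤ 1 / 2 := by
        rw [div_le_iff₀ hLpos]; linarith
      linarith
    simp only
    rw [pPart_of_pos (by linarith)]
    norm_num
    nlinarith
  · intro x
    simp only [grad, hφd]
    have hset : (x - c).1 ^ 2 + (x - c).2 ^ 2 = rho c x := rfl
    by_cases hx : rho c x < R ^ 2
    · rw [indicator_of_mem (show x - c ∈ {x : ℝ × ℝ | x.1 ^ 2 + x.2 ^ 2 < R ^ 2} from hx)]
      have hp : 0 < ε ^ 2 + rho c x := by have := rho_nonneg c x; positivity
      simp only [hset, hψd, mul_one, mul_zero, add_zero, zero_add]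
      have b1 : pPart (ψ x) ^ 2 ≤ 1 := by
        have : pPart (ψ x) ≤ 1 := max_le (hψle x) zero_le_one
        have := pPart_nonneg (ψ x)
        nlinarith
      have b2 : rho c x / (ε ^ 2 + rho c x) ≤ 1 := by
        rw [div_le_one hp]; nlinarith [sq_nonneg ε]
      have b3 : 0 ≤ rho c x / (ε ^ 2 + rho c x) := div_nonneg (rho_nonneg _ _) hp.le
      calc _ = 16 / L ^ 2 * (1 / (ε ^ 2 + rho c x)) *
            (pPart (ψ x) ^ 2 * (rho c x / (ε ^ 2 + rho c x))) := by
            field_simp; unfold rho; ring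
        _ ≤ 16 / L ^ 2 * (1 / (ε ^ 2 + rho c x)) * (1 * 1) := by gcongr
        _ = _ := by ring
    · rw [indicator_of_notMem (show x - c ∉ {x : ℝ × ℝ | x.1 ^ 2 + x.2 ^ 2 < R ^ 2} from hx),
        pPart_of_nonpos (hψneg x (not_lt.mp hx))]
      simp

lemma grad_smul (a : ℝ) {φ : ℝ × ℝ → ℝ} (hφ : Differentiable ℝ φ) (x : ℝ × ℝ) :
    grad (fun y => a * φ y) x = (a * (grad φ x).1, a * (grad φ x).2) := by
  unfold grad
  rw [fderiv_const_mul (hφ x)]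
  simp

lemma KHform_smul (k a : ℝ) (x b : ℝ × ℝ) :
    KHform k x (a * b.1, a * b.2) (a * b.1, a * b.2) = a ^ 2 * KHform k x b b := by
  unfold KHform; ring

lemma continuous_form {k : ℝ} (hk : 0 < k) {φ : ℝ × ℝ → ℝ} (hφ : ContDiff ℝ 1 φ) :
    Continuous (fun x => KHform k x (grad φ x) (grad φ x)) := by
  have h1 : ∀ e : ℝ × ℝ, Continuous (fun x => fderiv ℝ φ x e) := fun e =>
    (hφ.continuous_fderiv one_ne_zero).clm_apply continuous_const
  have h10 := h1 (1,0)
  have h01 := h1 (0,1)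
  have h0 := (contDiff_coef hk).continuous
  unfold KHform grad
  simp only
  fun_prop

lemma energy_le {k : ℝ} (hk : 0 < k) {Ω : Set (ℝ × ℝ)}
    (hb : Bornology.IsBounded Ω) {φ : ℝ × ℝ → ℝ} (hφ : ContDiff ℝ 1 φ) {c : ℝ × ℝ} {R ε : ℝ}
    (hR : 0 < R) (hε : 0 < ε)
    (hg : ∀ x, (grad φ x).1 ^ 2 + (grad φ x).2 ^ 2 ≤ 16 / (Real.log (1 + R ^ 2 / ε ^ 2)) ^ 2 *
        ({x : ℝ × ℝ | x.1 ^ 2 + x.2 ^ 2 < R ^ 2}).indicator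
          (fun x => 1 / (ε ^ 2 + (x.1 ^ 2 + x.2 ^ 2))) (x - c)) :
    IntegrableOn (fun x => KHform k x (grad φ x) (grad φ x)) Ω ∧
    ∫ x in Ω, KHform k x (grad φ x) (grad φ x) ≤ 16 * π / Real.log (1 + R ^ 2 / ε ^ 2) := by
  set L := Real.log (1 + R ^ 2 / ε ^ 2) with hL
  have hLpos : 0 < L := Real.log_pos (by have : 0 < R ^ 2 / ε ^ 2 := by positivity
                                         linarith)
  have i0 : IntegrableOn (fun x => KHform k x (grad φ x) (grad φ x)) Ω :=
    ((continuous_form hk hφ).continuousOn.integrableOn_compact hb.isCompact_closure).mono_set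
      subset_closure
  refine ⟨i0, ?_⟩
  set F : ℝ × ℝ → ℝ := ({x : ℝ × ℝ | x.1 ^ 2 + x.2 ^ 2 < R ^ 2}).indicator
      (fun x => 1 / (ε ^ 2 + (x.1 ^ 2 + x.2 ^ 2)))
  have hF : Integrable F := by
    by_contra hn
    have := polar_integral hR hε
    rw [integral_undef hn] at this
    have : 0 < π * L := mul_pos Real.pi_pos hLpos
    linarith
  have hF0 : ∀ x, 0 ≤ F x := fun x => indicator_nonneg (fun y _ => by positivity) x
  have hFc : Integrable (fun x => F (x - c)) := hF.comp_sub_right c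
  calc ∫ x in Ω, KHform k x (grad φ x) (grad φ x)
      ≤ ∫ x in Ω, 16 / L ^ 2 * F (x - c) :=
        setIntegral_mono i0 (hFc.const_mul _).integrableOn
          fun x => (KHform_le hk x _).trans (hg x)
    _ ≤ ∫ x, 16 / L ^ 2 * F (x - c) :=
        setIntegral_le_integral (hFc.const_mul _)
          (Eventually.of_forall fun x => mul_nonneg (by positivity) (hF0 _))
    _ = 16 / L ^ 2 * ∫ x, F x := by
        rw [integral_const_mul, integral_sub_right_eq_self F c]
    _ = 16 / L ^ 2 * (π * L) := by rw [polar_integral hR hε]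
    _ = _ := by field_simp
lemma ceps_le_of_testfn {k p ε E : ℝ} (hk : 0 < k) (hp : 1 < p) (hε : 0 < ε)
    (hE : 0 ≤ E) {Ω : Set (ℝ × ℝ)} (hℓ : 0 < Real.log (1 / ε)) {q φ : ℝ × ℝ → ℝ}
    (hq0 : ∀ x ∈ closure Ω, 0 < q x)
    (hφ : ContDiff ℝ 1 φ) (hφ0 : ∀ x ∈ frontier Ω, φ x = 0)
    (hi : IntegrableOn (fun x => KHform k x (grad φ x) (grad φ x)) Ω)
    (hφE : ∫ x in Ω, KHform k x (grad φ x) (grad φ x) ≤ E)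
    (A : ℝ) (hneg : Ieps k p ε q Ω (fun y => A * φ y) < 0) (hΩo : IsOpen Ω) :
    ceps k p q Ω ε ≤ A ^ 2 * E / 2 := by
  have hd : Differentiable ℝ φ := hφ.differentiable one_ne_zero
  have hen : ∀ a : ℝ, ∫ x in Ω, KHform k x (grad (fun y => a * φ y) x) (grad (fun y => a * φ y) x)
      = a ^ 2 * ∫ x in Ω, KHform k x (grad φ x) (grad φ x) := by
    intro a
    rw [← integral_const_mul]
    refine integral_congr_ae (Eventually.of_forall fun x => ?_)
    simp only
    rw [grad_smul a hd, KHform_smul]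
  have hIle : ∀ a : ℝ, Ieps k p ε q Ω (fun y => a * φ y) ≤ a ^ 2 * E / 2 := by
    intro a
    unfold Ieps
    rw [hen]
    have h1 : 0 ≤ (1 / ((p + 1) * ε ^ 2)) *
        ∫ x in Ω, pPart (a * φ x - q x * Real.log (1 / ε)) ^ (p + 1) :=
      mul_nonneg (by have : 0 < p + 1 := by linarith
                     positivity) (integral_nonneg fun _ => Real.rpow_nonneg (pPart_nonneg _) _)
    have h2 : a ^ 2 * ∫ x in Ω, KHform k x (grad φ x) (grad φ x) ≤ a ^ 2 * E := by gcongr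
    linarith
  unfold ceps
  refine le_trans (csInf_le ?_ ⟨fun t y => t * A * φ y, ?_, ?_, ?_, ?_, rfl⟩) ?_
  · refine ⟨0, ?_⟩
    rintro c ⟨γ, -, -, hγ0, -, rfl⟩
    have hI0 : Ieps k p ε q Ω (γ 0) = 0 := by
      rw [hγ0]
      unfold Ieps
      have e1 : ∀ x, grad (fun _ : ℝ × ℝ => (0:ℝ)) x = (0, 0) := fun x => by simp [grad]
      have e2 : ∫ x in Ω, pPart (0 - q x * Real.log (1 / ε)) ^ (p + 1) = 0 := by
        refine setIntegral_eq_zero_of_forall_eq_zero fun x hx => ?_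
        have := mul_pos (hq0 x (subset_closure hx)) hℓ
        rw [pPart_of_nonpos (by linarith), Real.zero_rpow (by linarith)]
      rw [e2]
      simp [e1, KHform]
    by_cases hbd : BddAbove ((fun t => Ieps k p ε q Ω (γ t)) '' Icc (0:ℝ) 1)
    · refine le_csSup_of_le hbd ⟨0, ⟨le_rfl, zero_le_one⟩, rfl⟩ ?_
      simp only [hI0, le_refl]
    · rw [Real.sSup_of_not_bddAbove hbd]
  · intro t _
    refine ⟨(continuous_const.mul hφ.continuous).continuousOn, (contDiff_const.mul hφ).contDiffOn,
      fun x hx => by simp [hφ0 x hx], ?_⟩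
    have : (fun x => KHform k x (grad (fun y => t * A * φ y) x) (grad (fun y => t * A * φ y) x))
      = fun x => (t * A) ^ 2 * KHform k x (grad φ x) (grad φ x) := by
      funext x; rw [grad_smul _ hd, KHform_smul]
    rw [this]
    exact hi.const_mul _
  · intro t _ δ hδ
    refine ⟨Real.sqrt (δ / (A ^ 2 * E + 1)), Real.sqrt_pos.mpr (by positivity), fun s _ hst => ?_⟩
    have e : (fun y => s * A * φ y - t * A * φ y) = fun y => ((s - t) * A) * φ y := by
      funext y; ring
    simp only [e]
    rw [hen]
    have h1 : (s - t) ^ 2 < δ / (A ^ 2 * E + 1) := by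
      rw [← sq_abs]; exact (Real.lt_sqrt (abs_nonneg _)).mp hst
    rw [lt_div_iff₀ (by positivity)] at h1
    have h2 : ((s - t) * A) ^ 2 * ∫ x in Ω, KHform k x (grad φ x) (grad φ x) ≤
      ((s - t) * A) ^ 2 * E := by gcongr
    nlinarith [sq_nonneg (s - t)]
  · funext y; simp
  · simpa using hneg
  · refine csSup_le ⟨_, 0, ⟨le_rfl, zero_le_one⟩, rfl⟩ ?_
    rintro _ ⟨t, ht, rfl⟩
    refine (hIle (t * A)).trans ?_
    have : t ^ 2 ≤ 1 := by nlinarith [ht.1, ht.2]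
    have h3 : 0 ≤ A ^ 2 * E := by positivity
    have : t ^ 2 * (A ^ 2 * E) ≤ 1 * (A ^ 2 * E) := by gcongr
    nlinarith

lemma ceps_le {k p : ℝ} (hk : 0 < k) (hp : 1 < p) {Ω : Set (ℝ × ℝ)} (hΩo : IsOpen Ω)
    (hne : Ω.Nonempty) (hb : Bornology.IsBounded Ω) {q : ℝ × ℝ → ℝ}
    (hqc : ContinuousOn q (closure Ω)) (hq0 : ∀ x ∈ closure Ω, 0 < q x) :
    ∃ C : ℝ, 0 ≤ C ∧ ∀ᶠ ε in 𝓝[>] (0:ℝ), ceps k p q Ω ε ≤ C * Real.log (1 / ε) := by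
  obtain ⟨c, hc⟩ := hne
  obtain ⟨r, hr, hball⟩ := Metric.isOpen_iff.mp hΩo c hc
  obtain ⟨Q0, hQ0⟩ := hb.isCompact_closure.exists_bound_of_continuousOn hqc
  set Q := max Q0 1
  have hQ1 : 1 ≤ Q := le_max_right _ _
  have hqQ : ∀ x ∈ closure Ω, q x ≤ Q := fun x hx =>
    (le_abs_self _).trans ((hQ0 x hx).trans (le_max_left _ _))
  have hrho : ∀ x, rho c x < r ^ 2 → x ∈ Ω := by
    intro x hx
    refine hball ?_
    rw [Metric.mem_ball, Prod.dist_eq, max_lt_iff, Real.dist_eq, Real.dist_eq]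
    unfold rho at hx
    constructor <;> refine abs_lt_of_sq_lt_sq ?_ hr.le <;> nlinarith [sq_nonneg (x.1 - c.1),
      sq_nonneg (x.2 - c.2)]
  set R := r with hRdef
  set T := 8 * Q
  have tlog : Tendsto (fun ε : ℝ => Real.log (1 / ε)) (𝓝[>] 0) atTop := by
    simp only [one_div]
    exact Real.tendsto_log_atTop.comp tendsto_inv_nhdsGT_zero
  have tpow : Tendsto (fun ε : ℝ => Real.log (1 / ε) ^ p) (𝓝[>] 0) atTop :=
    (tendsto_rpow_atTop (by linarith)).comp tlog
  refine ⟨8 * π * T ^ 2, by positivity, ?_⟩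
  filter_upwards [tlog.eventually_ge_atTop (max 1 (-2 * Real.log R)),
    tlog.eventually_ge_atTop (2 * Real.log 2),
    tpow.eventually_gt_atTop (8 * π * T ^ 2 * (p + 1)),
    Ioo_mem_nhdsGT (show (0:ℝ) < R from hr)] with ε h1 h2 h3 h4
  have hε : 0 < ε := h4.1
  set ℓ := Real.log (1 / ε) with hℓdef
  have hℓ1 : 1 ≤ ℓ := (le_max_left _ _).trans h1
  have hℓR : -2 * Real.log R ≤ ℓ := (le_max_right _ _).trans h1
  have hL : ℓ ≤ Real.log (1 + R ^ 2 / ε ^ 2) := by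
    have a1 : Real.log (R ^ 2 / ε ^ 2) ≤ Real.log (1 + R ^ 2 / ε ^ 2) :=
      Real.log_le_log (by positivity) (by linarith)
    have a2 : Real.log (R ^ 2 / ε ^ 2) = 2 * Real.log R + 2 * ℓ := by
      rw [hℓdef, Real.log_div (by positivity) (by positivity), Real.log_pow, Real.log_pow,
        one_div, Real.log_inv]; push_cast; ring
    linarith
  obtain ⟨φ, hφ, hφ0, hφ4, hφg⟩ := exists_testfn c (show 0 < R from hr) hε
  obtain ⟨hi, hE⟩ := energy_le hk hb hφ (show 0 < R from hr) hε hφg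
  have hE' : ∫ x in Ω, KHform k x (grad φ x) (grad φ x) ≤ 16 * π / ℓ :=
    hE.trans (by gcongr)
  have hfr : ∀ x ∈ frontier Ω, φ x = 0 := by
    intro x hx
    refine hφ0 x ?_
    by_contra hn
    rw [frontier, hΩo.interior_eq] at hx
    exact hx.2 (hrho x (not_le.mp hn))
  have hneg : Ieps k p ε q Ω (fun y => T * ℓ * φ y) < 0 := by
    have hd : Differentiable ℝ φ := hφ.differentiable one_ne_zero
    have hen : ∫ x in Ω, KHform k x (grad (fun y => T * ℓ * φ y) x) (grad (fun y => T * ℓ * φ y) x)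
        = (T * ℓ) ^ 2 * ∫ x in Ω, KHform k x (grad φ x) (grad φ x) := by
      rw [← integral_const_mul]
      refine integral_congr_ae (Eventually.of_forall fun x => ?_)
      simp only
      rw [grad_smul _ hd, KHform_smul]
    unfold Ieps
    rw [hen, ← hℓdef]
    set W : ℝ × ℝ → ℝ := fun x => pPart (T * ℓ * φ x - q x * ℓ) ^ (p + 1) with hW
    have hWc : ContinuousOn W (closure Ω) :=
      (continuous_pPart_rpow (by linarith)).comp_continuousOn
        ((continuous_const.mul hφ.continuous).continuousOn.sub (hqc.mul continuousOn_const))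
    have hWi : IntegrableOn W Ω :=
      (hWc.integrableOn_compact hb.isCompact_closure).mono_set subset_closure
    have hW0 : ∀ x, 0 ≤ W x := fun x => Real.rpow_nonneg (pPart_nonneg _) _
    set B := Metric.ball c (ε / 2)
    have hBrho : ∀ x ∈ B, rho c x ≤ ε ^ 2 := by
      intro x hx
      rw [Metric.mem_ball, Prod.dist_eq, max_lt_iff, Real.dist_eq, Real.dist_eq] at hx
      have a1 := sq_lt_sq' (abs_lt.mp hx.1).1 (abs_lt.mp hx.1).2
      have a2 := sq_lt_sq' (abs_lt.mp hx.2).1 (abs_lt.mp hx.2).2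
      unfold rho
      nlinarith
    have hBΩ : B ⊆ Ω := fun x hx => hrho x (lt_of_le_of_lt (hBrho x hx) (by
      have := h4.2; gcongr))
    have hBvol : volume.real B = ε ^ 2 := by
      have : B = Metric.ball c.1 (ε/2) ×ˢ Metric.ball c.2 (ε/2) := (ball_prod_same _ _ _).symm
      rw [this, Measure.volume_eq_prod, measureReal_prod_prod, Real.volume_real_ball (by positivity),
        Real.volume_real_ball (by positivity)]; ring
    have hlow : ε ^ 2 * ℓ ^ (p + 1) ≤ ∫ x in Ω, W x := by
      calc ε ^ 2 * ℓ ^ (p + 1) = ∫ x in B, ℓ ^ (p + 1) := by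
            rw [setIntegral_const, hBvol, smul_eq_mul]
        _ ≤ ∫ x in B, W x := by
            refine setIntegral_mono_on (integrableOn_const (measure_ball_lt_top).ne)
              (hWi.mono_set hBΩ) measurableSet_ball fun x hx => ?_
            have b1 := hφ4 (h2.trans hL) x (hBrho x hx)
            have b2 := hqQ x (subset_closure (hBΩ hx))
            simp only [hW]
            refine Real.rpow_le_rpow (by linarith) ?_ (by linarith)
            refine le_trans ?_ (le_max_left _ _)
            have : 1 ≤ T * φ x - q x := by
              have : T * (1/4) ≤ T * φ x := by gcongr
              simp only [T] at this ⊢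
              linarith
            nlinarith
        _ ≤ ∫ x in Ω, W x :=
            setIntegral_mono_set hWi (Eventually.of_forall hW0) hBΩ.eventuallyLE
    have b3 : (T * ℓ) ^ 2 * ∫ x in Ω, KHform k x (grad φ x) (grad φ x) ≤
        16 * π * T ^ 2 * ℓ := by
      calc _ ≤ (T * ℓ) ^ 2 * (16 * π / ℓ) := by gcongr
        _ = _ := by field_simp
    have b4 : 1 / ((p + 1) * ε ^ 2) * (ε ^ 2 * ℓ ^ (p + 1)) ≤
        1 / ((p + 1) * ε ^ 2) * ∫ x in Ω, W x := by
      have : 0 < p + 1 := by linarith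
      gcongr
    have b5 : 1 / ((p + 1) * ε ^ 2) * (ε ^ 2 * ℓ ^ (p + 1)) = ℓ ^ p * ℓ / (p + 1) := by
      have : 0 < p + 1 := by linarith
      rw [Real.rpow_add_one (by linarith)]
      field_simp
    have b6 : 8 * π * T ^ 2 * ℓ < ℓ ^ p * ℓ / (p + 1) := by
      rw [lt_div_iff₀ (by linarith)]
      nlinarith
    linarith
  refine (ceps_le_of_testfn hk hp hε (by positivity) (by linarith) hq0 hφ hfr hi hE' (T * ℓ) hneg
    hΩo).trans (le_of_eq ?_)
  field_simp
  ring

lemma LH_sub {k : ℝ} (hk : 0 < k) {Ω : Set (ℝ × ℝ)} (hΩ : IsOpen Ω) {u q : ℝ × ℝ → ℝ}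
    (hu : ContDiffOn ℝ 2 u Ω) (hq : ContDiffOn ℝ 2 q Ω) (ℓ : ℝ) {x : ℝ × ℝ} (hx : x ∈ Ω) :
    LH k (fun y => u y - q y * ℓ) x = LH k u x - ℓ * LH k q x := by
  have hg : ∀ y ∈ Ω, ∀ e, fderiv ℝ (fun y => u y - q y * ℓ) y e =
      fderiv ℝ u y e - fderiv ℝ q y e * ℓ := by
    intro y hy e
    have a1 := (hu.contDiffAt (hΩ.mem_nhds hy)).differentiableAt two_ne_zero
    have a2 := (hq.contDiffAt (hΩ.mem_nhds hy)).differentiableAt two_ne_zero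
    rw [fderiv_fun_sub a1 (a2.mul_const ℓ), fderiv_mul_const a2]
    simp [mul_comm]
  have d1 := fun (w : ℝ × ℝ → ℝ) (hw : ContDiffOn ℝ 2 w Ω) =>
    ((contDiffOn_vec1 hk hΩ hw).contDiffAt (hΩ.mem_nhds hx)).differentiableAt one_ne_zero
  have d2 := fun (w : ℝ × ℝ → ℝ) (hw : ContDiffOn ℝ 2 w Ω) =>
    ((contDiffOn_vec2 hk hΩ hw).contDiffAt (hΩ.mem_nhds hx)).differentiableAt one_ne_zero
  have e1 : (fun y => (KHvec k y (grad (fun y => u y - q y * ℓ) y)).1) =ᶠ[𝓝 x]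
      fun y => (KHvec k y (grad u y)).1 - (KHvec k y (grad q y)).1 * ℓ := by
    filter_upwards [hΩ.mem_nhds hx] with y hy
    simp only [KHvec, grad, hg y hy]; ring
  have e2 : (fun y => (KHvec k y (grad (fun y => u y - q y * ℓ) y)).2) =ᶠ[𝓝 x]
      fun y => (KHvec k y (grad u y)).2 - (KHvec k y (grad q y)).2 * ℓ := by
    filter_upwards [hΩ.mem_nhds hx] with y hy
    simp only [KHvec, grad, hg y hy]; ring
  unfold LH div2
  simp only
  rw [e1.fderiv_eq, e2.fderiv_eq, fderiv_fun_sub (d1 u hu) ((d1 q hq).mul_const ℓ),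
    fderiv_fun_sub (d2 u hu) ((d2 q hq).mul_const ℓ), fderiv_mul_const (d1 q hq),
    fderiv_mul_const (d2 q hq)]
  simp
  ring

lemma mass_bound {k p ε m : ℝ} (hk : 0 < k) (hp : 1 < p) (hε : 0 < ε) {Ω : Set (ℝ × ℝ)}
    (hΩo : IsOpen Ω) (hb : Bornology.IsBounded Ω) (hℓ : 0 < Real.log (1 / ε))
    {q u : ℝ × ℝ → ℝ} (hqc : ContinuousOn q (closure Ω)) (hm : 0 < m)
    (hqm : ∀ x ∈ closure Ω, m ≤ q x) (hs : IsSolution k p ε q Ω u) (hH : MemH k Ω u) :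
    m * Real.log (1 / ε) / 4 * (1 / ε ^ 2 *
      ∫ x in Ω, pPart (u x - q x * Real.log (1 / ε)) ^ p) ≤ Ieps k p ε q Ω u := by
  obtain ⟨uc, u2, ufr, hL⟩ := hs
  set ℓ := Real.log (1 / ε)
  set s := 1 / ε ^ 2 with hsdef
  have hs0 : 0 < s := by positivity
  set δ := m * ℓ / 2 with hδ
  have hδ0 : 0 < δ := by positivity
  set v : ℝ × ℝ → ℝ := fun y => u y - (fun _ => (1:ℝ)) y * δ with hv
  have hveq : ∀ x, v x = u x - δ := fun x => by simp [hv]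
  have v2 : ContDiffOn ℝ 2 v Ω := u2.sub contDiffOn_const
  have vc : ContinuousOn v (closure Ω) := uc.sub continuousOn_const
  have hA : Adm Ω v := ⟨hΩo, hb, vc, fun x hx => by rw [hveq, ufr x hx]; linarith,
    v2.of_le one_le_two⟩
  set w : ℝ × ℝ → ℝ := fun x => u x - q x * ℓ with hw
  have wc : ContinuousOn w (closure Ω) := uc.sub (hqc.mul continuousOn_const)
  have hLv : ∀ x ∈ Ω, LH k v x = s * pPart (w x) ^ p := by
    intro x hx
    have := LH_sub hk hΩo u2 (contDiffOn_const (c := (1:ℝ))) δ hx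
    rw [show LH k v x = _ from this, hL x hx]
    simp [LH, div2, KHvec, grad, hw]
  have fc : ContinuousOn (fun x => s * pPart (w x) ^ p) (closure Ω) :=
    continuousOn_const.mul ((continuous_pPart_rpow (by linarith)).comp_continuousOn wc)
  have t := test_limit hk hA v2 (fc.mono subset_closure) hLv
  have hgr : ∀ x, grad v x = grad u x := fun x => by
    simp only [hv, grad]; rw [fderiv_sub_const]
  simp only [hgr] at t
  have t1 : ∫ x in {x ∈ Ω | 0 < v x}, KHform k x (grad u x) (grad u x) ≤
      ∫ x in Ω, KHform k x (grad u x) (grad u x) :=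
    setIntegral_mono_set hH.2.2.2 (Eventually.of_forall fun x => KHform_nonneg hk _ _)
      (LE.le.eventuallyLE fun x hx => hx.1)
  have t2 : ∫ x in Kc Ω v, s * pPart (w x) ^ p * pPart (v x) =
      ∫ x in Ω, s * pPart (w x) ^ p * pPart (v x) := by
    refine (setIntegral_eq_of_subset_of_forall_sdiff_eq_zero hΩo.measurableSet hA.subset ?_).symm
    rintro x ⟨hx, hn⟩
    have : v x < 0 := by
      by_contra h0
      exact hn ⟨subset_closure hx, not_lt.mp h0⟩
    rw [pPart_of_nonpos this.le, mul_zero]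
  have hint : ∀ {F : ℝ × ℝ → ℝ}, ContinuousOn F (closure Ω) → IntegrableOn F Ω := fun hF =>
    (hF.integrableOn_compact hb.isCompact_closure).mono_set subset_closure
  have i1 : IntegrableOn (fun x => pPart (w x) ^ (p + 1)) Ω :=
    hint ((continuous_pPart_rpow (by linarith)).comp_continuousOn wc)
  have i0 : IntegrableOn (fun x => pPart (w x) ^ p) Ω :=
    hint ((continuous_pPart_rpow (by linarith)).comp_continuousOn wc)
  have t3 : s * (∫ x in Ω, pPart (w x) ^ (p + 1)) + s * δ * (∫ x in Ω, pPart (w x) ^ p) ≤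
      ∫ x in Ω, s * pPart (w x) ^ p * pPart (v x) := by
    rw [← integral_const_mul, ← integral_const_mul, ← integral_add (i1.const_mul _)
      (i0.const_mul _)]
    refine setIntegral_mono_on ((i1.const_mul _).add (i0.const_mul _))
      (hint (fc.mul (continuous_pPart.comp_continuousOn vc))) hΩo.measurableSet fun x hx => ?_
    rw [Real.rpow_add_one' (pPart_nonneg _) (by linarith)]
    by_cases h0 : 0 < w x
    · have hq := hqm x (subset_closure hx)
      have a1 : w x + δ ≤ pPart (v x) := by
        refine le_trans ?_ (le_max_left _ _)
        rw [hveq, hw]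
        simp only [hδ]
        nlinarith
      rw [pPart_of_pos h0]
      have : 0 ≤ s * w x ^ p := mul_nonneg hs0.le (Real.rpow_nonneg h0.le _)
      nlinarith
    · rw [pPart_of_nonpos (not_lt.mp h0), Real.zero_rpow (by linarith)]; simp
  have hJ1 : 0 ≤ ∫ x in Ω, pPart (w x) ^ (p + 1) :=
    integral_nonneg fun _ => Real.rpow_nonneg (pPart_nonneg _) _
  have e : 1 / ((p + 1) * ε ^ 2) = s * (1 / (p + 1)) := by
    rw [hsdef]; field_simp
  have h12 : 1 / (p + 1) ≤ 1 / 2 := one_div_le_one_div_of_le (by norm_num) (by linarith)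
  unfold Ieps
  rw [e]
  have h5 : s * (1 / (p + 1)) * (∫ x in Ω, pPart (w x) ^ (p + 1)) ≤
      s * (1 / 2) * (∫ x in Ω, pPart (w x) ^ (p + 1)) := by gcongr
  have h6 : m * ℓ / 4 * (s * ∫ x in Ω, pPart (w x) ^ p) =
    1 / 2 * (s * δ * (∫ x in Ω, pPart (w x) ^ p)) := by rw [hδ]; ring
  rw [h6]
  linarith

/-- Lemma 3.3: the energy of the vortex core is bounded uniformly
in `ε`: `∫_{A_ε} (K_H ∇(u_ε - q ln(1/ε)) | ∇(u_ε - q ln(1/ε))) ≤ C`. -/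
theorem statement11 (k p : ℝ) (hk : 0 < k) (hp : 1 < p)
    (Ω : Set (ℝ × ℝ)) (hΩo : IsOpen Ω) (hΩc : IsConnected Ω)
    (hΩb : Bornology.IsBounded Ω) (hΩsc : SimplyConnectedSpace ↥Ω)
    (q : ℝ × ℝ → ℝ) (hq1 : ContDiffOn ℝ 2 q Ω) (hq2 : ContDiffOn ℝ 1 q (closure Ω))
    (hq3 : ∀ x ∈ closure Ω, 0 < q x) (hq4 : ∀ x ∈ Ω, LH k q x = 0)
    (hmin : ∃ x0 ∈ closure Ω, x0.2 = 0 ∧ ∀ y ∈ closure Ω, Qfun k q x0 ≤ Qfun k q y)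
    (u : ℝ → ℝ × ℝ → ℝ)
    (hu : ∀ ε ∈ Set.Ioo (0:ℝ) 1, IsMPSolution k p ε q Ω (u ε))
    :
    ∃ C : ℝ, ∀ᶠ ε in 𝓝[>] (0:ℝ),
      (∫ x in vcore q Ω ε (u ε),
        KHform k x (grad (fun y => u ε y - q y * Real.log (1 / ε)) x)
          (grad (fun y => u ε y - q y * Real.log (1 / ε)) x)) ≤ C := by
  have hqc : ContinuousOn q (closure Ω) := hq2.continuousOn
  have hcpt : IsCompact (closure Ω) := hΩb.isCompact_closure
  obtain ⟨xm, hxm, hmin'⟩ := hcpt.exists_isMinOn hΩc.nonempty.closure hqc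
  set m := q xm
  have hm : 0 < m := hq3 xm hxm
  have hqm : ∀ x ∈ closure Ω, m ≤ q x := fun x hx => hmin' hx
  obtain ⟨R, hR⟩ : ∃ R : ℝ, ∀ x ∈ Ω, k ^ 2 + x.1 ^ 2 + x.2 ^ 2 ≤ R := by
    obtain ⟨R, hR⟩ := hcpt.exists_bound_of_continuousOn
      (f := fun x : ℝ × ℝ => k ^ 2 + x.1 ^ 2 + x.2 ^ 2) (by fun_prop)
    exact ⟨R, fun x hx => (le_abs_self _).trans (hR x (subset_closure hx))⟩
  obtain ⟨C1, hC1, hcore⟩ := core_bound (R := R) hp hk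
  obtain ⟨C2, hC2, hceps⟩ := ceps_le hk hp hΩo hΩc.nonempty hΩb hqc hq3
  refine ⟨C1 * (4 * C2 / m) ^ 2, ?_⟩
  filter_upwards [hceps, Ioo_mem_nhdsGT (zero_lt_one' ℝ)] with ε hc hε
  obtain ⟨hs, hH, hI⟩ := hu ε hε
  have hℓ : 0 < Real.log (1 / ε) := Real.log_pos (by rw [lt_div_iff₀ hε.1]; linarith [hε.2])
  have hmass := mass_bound hk hp hε.1 hΩo hΩb hℓ hqc hm hqm hs hH
  obtain ⟨uc, u2, ufr, hL⟩ := hs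
  set ℓ := Real.log (1 / ε)
  set v : ℝ × ℝ → ℝ := fun y => u ε y - q y * ℓ with hv
  have hA : Adm Ω v := by
    refine ⟨hΩo, hΩb, uc.sub (hqc.mul continuousOn_const), fun x hx => ?_,
      (u2.sub (hq1.mul contDiffOn_const)).of_le one_le_two⟩
    have := mul_pos (hq3 x (frontier_subset_closure hx)) hℓ
    simp only [hv, ufr x hx]; linarith
  have hset : vcore q Ω ε (u ε) = {x ∈ Ω | 0 < v x} := by
    ext x
    simp only [vcore, hv]
    exact and_congr_right fun _ => sub_pos.symm
  rw [hset]
  have hb := hcore Ω v (1 / ε ^ 2) (by have := hε.1; positivity) hR hA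
    (u2.sub (hq1.mul contDiffOn_const)) (fun x hx => by
      rw [hv, LH_sub hk hΩo u2 hq1 ℓ hx, hq4 x hx, hL x hx]; ring)
  have hK : ∫ x in Kc Ω v, pPart (v x) ^ p = ∫ x in Ω, pPart (v x) ^ p := by
    refine (setIntegral_eq_of_subset_of_forall_sdiff_eq_zero hΩo.measurableSet hA.subset ?_).symm
    rintro x ⟨hx, hn⟩
    have : v x < 0 := by
      by_contra h0
      exact hn ⟨subset_closure hx, not_lt.mp h0⟩
    rw [pPart_of_nonpos this.le, Real.zero_rpow (by linarith)]
  rw [hK] at hb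
  refine hb.trans ?_
  have hM0 : 0 ≤ 1 / ε ^ 2 * ∫ x in Ω, pPart (v x) ^ p :=
    mul_nonneg (by positivity) (integral_nonneg fun _ => Real.rpow_nonneg (pPart_nonneg _) _)
  have hM : 1 / ε ^ 2 * ∫ x in Ω, pPart (v x) ^ p ≤ 4 * C2 / m := by
    rw [le_div_iff₀ hm]
    have h1 := (hmass.trans (le_of_eq hI)).trans hc
    have h2 : ℓ * ((1 / ε ^ 2 * ∫ x in Ω, pPart (v x) ^ p) * m) ≤ ℓ * (4 * C2) := by
      have : m * ℓ / 4 * (1 / ε ^ 2 * ∫ x in Ω, pPart (v x) ^ p) ≤ C2 * ℓ := h1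
      linarith
    exact le_of_mul_le_mul_left h2 hℓ
  gcongr
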